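/- Let v ∈ C²(ω, ℝ^k) and w ∈ C¹(ω, ℝ^d) on an open domain ω ⊂ ℝ^d, let η ∈ ℝ^d and E ∈ ℝ^k be unit vectors, λ > 0 and a ∈ C²(ω, ℝ). Define Γ(t) = 2 sin t, Γ̄(t) = −½ cos(2t), Γ̄̄(t) = −½ sin(2t), and t_η = ⟨x, η⟩. Set ṽ(x) = v(x) + (1/λ)·a(x)·Γ(λt_η)·E and w̃(x) = w(x) − (1/λ)·a(x)·Γ(λt_η)·∇⟨v(x), E⟩ − (1/λ²)·a(x)·Γ̄(λt_η)·∇a(x) + (1/λ)·a(x)²·Γ̄̄(λt_η)·η. Then (½(∇ṽ)ᵀ∇ṽ + sym∇w̃) − (½(∇v)ᵀ∇v + sym∇w) − a²·η⊗η = −(1/λ)·a·Γ(λt_η)·∇²⟨v, E⟩ + (1/λ²)·(½Γ(λt_η)² − Γ̄(λt_η))·∇a⊗∇a − (1/λ²)·a·Γ̄(λt_η)·∇²a, where ½Γ(t)² − Γ̄(t) = 1 − ½cos(2t). -/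

import Mathlib

noncomputable section
open Real
open scoped BigOperators

/-- Partial derivative of `f` in the `i`-th coordinate direction. -/
def pd {d : ℕ} {E : Type*} [NormedAddCommGroup E] [NormedSpace ℝ E]
    (i : Fin d) (f : (Fin d → ℝ) → E) (x : Fin d → ℝ) : E :=
  fderiv ℝ f x (Pi.single i 1)

/-- The matrix `(∇v)ᵀ∇v`, with entries `⟨∂ᵢv, ∂ⱼv⟩`. -/
def gradTgrad {d k : ℕ} (v : (Fin d → ℝ) → Fin k → ℝ) (x : Fin d → ℝ) :
    Fin d → Fin d → ℝ :=
  fun i j => ∑ l, pd i (fun y => v y l) x * pd j (fun y => v y l) x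

/-- The symmetrized gradient `sym∇w = ½(∇w + (∇w)ᵀ)`. -/
def symGrad {d : ℕ} (w : (Fin d → ℝ) → Fin d → ℝ) (x : Fin d → ℝ) :
    Fin d → Fin d → ℝ :=
  fun i j => (pd i (fun y => w y j) x + pd j (fun y => w y i) x) / 2

section PartialDerivatives

variable {d : ℕ} {f g : (Fin d → ℝ) → ℝ} {x : Fin d → ℝ}

theorem pd_add (i : Fin d) (hf : DifferentiableAt ℝ f x) (hg : DifferentiableAt ℝ g x) :
    pd i (fun y => f y + g y) x = pd i f x + pd i g x := by
  simp only [pd, fderiv_fun_add hf hg, add_apply]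

theorem pd_sub (i : Fin d) (hf : DifferentiableAt ℝ f x) (hg : DifferentiableAt ℝ g x) :
    pd i (fun y => f y - g y) x = pd i f x - pd i g x := by
  simp only [pd, fderiv_fun_sub hf hg, sub_apply]

theorem pd_mul (i : Fin d) (hf : DifferentiableAt ℝ f x) (hg : DifferentiableAt ℝ g x) :
    pd i (fun y => f y * g y) x = f x * pd i g x + g x * pd i f x := by
  simp only [pd, fderiv_fun_mul hf hg, add_apply,
    smul_apply, smul_eq_mul]

theorem pd_const (i : Fin d) (c : ℝ) : pd i (fun _ : Fin d → ℝ => c) x = 0 := by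
  simp [pd]

theorem pd_sum_mul_const {k : ℕ} (i : Fin d) {v : (Fin d → ℝ) → Fin k → ℝ}
    (hv : ∀ l, DifferentiableAt ℝ (fun y => v y l) x) (E : Fin k → ℝ) :
    pd i (fun y => ∑ l, v y l * E l) x = ∑ l, pd i (fun y => v y l) x * E l := by
  have h := HasFDerivAt.fun_sum (u := Finset.univ)
    fun l _ => ((hv l).hasFDerivAt.mul_const (E l))
  simp only [pd, h.fderiv, sum_apply, smul_apply,
    smul_eq_mul, mul_comm]

theorem differentiableAt_sum_mul_const (η : Fin d → ℝ) :
    DifferentiableAt ℝ (fun y : Fin d → ℝ => ∑ i, y i * η i) x := by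
  fun_prop

theorem pd_linear (i : Fin d) (η : Fin d → ℝ) :
    pd i (fun y : Fin d → ℝ => ∑ i, y i * η i) x = η i := by
  rw [pd_sum_mul_const i (v := fun y => y) (fun l => by fun_prop) η]
  have h (l : Fin d) : pd i (fun y : Fin d → ℝ => y l) x = (Pi.single i 1 : Fin d → ℝ) l := by
    simp only [pd, (hasFDerivAt_apply l x).fderiv, ContinuousLinearMap.proj_apply]
  simp [h, Pi.single_apply]

theorem pd_sin (i : Fin d) (hf : DifferentiableAt ℝ f x) :
    pd i (fun y => Real.sin (f y)) x = Real.cos (f x) * pd i f x := by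
  simp only [pd, hf.hasFDerivAt.sin.fderiv, smul_apply, smul_eq_mul]

theorem pd_cos (i : Fin d) (hf : DifferentiableAt ℝ f x) :
    pd i (fun y => Real.cos (f y)) x = -Real.sin (f x) * pd i f x := by
  simp only [pd, hf.hasFDerivAt.cos.fderiv, smul_apply, smul_eq_mul]

theorem pd_sin_phase (i : Fin d) (c : ℝ) (η : Fin d → ℝ) :
    pd i (fun y : Fin d → ℝ => Real.sin (c * ∑ i', y i' * η i')) x
      = c * Real.cos (c * ∑ i', x i' * η i') * η i := by
  rw [pd_sin i (by fun_prop), pd_mul i (by fun_prop) (by fun_prop), pd_const, pd_linear]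
  ring

theorem pd_cos_phase (i : Fin d) (c : ℝ) (η : Fin d → ℝ) :
    pd i (fun y : Fin d → ℝ => Real.cos (c * ∑ i', y i' * η i')) x
      = -c * Real.sin (c * ∑ i', x i' * η i') * η i := by
  rw [pd_cos i (by fun_prop), pd_mul i (by fun_prop) (by fun_prop), pd_const, pd_linear]
  ring

theorem ContDiffAt.differentiableAt_fderiv (hf : ContDiffAt ℝ 2 f x) :
    DifferentiableAt ℝ (fderiv ℝ f) x :=
  (hf.fderiv_right (m := 1) (by norm_num)).differentiableAt (by norm_num)

theorem ContDiffAt.differentiableAt_pd (hf : ContDiffAt ℝ 2 f x) (i : Fin d) :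
    DifferentiableAt ℝ (fun y => pd i f y) x :=
  hf.differentiableAt_fderiv.clm_apply (differentiableAt_const _)

theorem ContDiffAt.pd_pd (hf : ContDiffAt ℝ 2 f x) (i j : Fin d) :
    pd i (fun y => pd j f y) x
      = fderiv ℝ (fderiv ℝ f) x (Pi.single i 1) (Pi.single j 1) := by
  have h := hf.differentiableAt_fderiv.hasFDerivAt.clm_apply
    (hasFDerivAt_const (Pi.single j 1 : Fin d → ℝ) x)
  change fderiv ℝ (fun y => fderiv ℝ f y (Pi.single j 1)) x _ = _
  simp [h.fderiv]

theorem ContDiffAt.pd_comm (hf : ContDiffAt ℝ 2 f x) (i j : Fin d) :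
    pd i (fun y => pd j f y) x = pd j (fun y => pd i f y) x := by
  rw [hf.pd_pd, hf.pd_pd]
  exact hf.isSymmSndFDerivAt (by simp) _ _

/-- Partial derivatives of a corrugated component of the map `v`. -/
theorem pd_corrugated_map (i : Fin d) {a : (Fin d → ℝ) → ℝ} (hf : DifferentiableAt ℝ f x)
    (ha : DifferentiableAt ℝ a x) {lam : ℝ} (hlam : lam ≠ 0) (η : Fin d → ℝ) (e : ℝ) :
    pd i (fun y => f y + (1 / lam) * a y * (2 * Real.sin (lam * ∑ i, y i * η i)) * e) x
      = pd i f x + ((1 / lam) * pd i a x * (2 * Real.sin (lam * ∑ i, x i * η i))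
          + a x * (2 * Real.cos (lam * ∑ i, x i * η i)) * η i) * e := by
  simp (discharger := fun_prop) only [pd_add, pd_mul, pd_const, pd_sin_phase]
  field_simp
  ring

/-- Partial derivatives of a corrugated component of the map `w`. -/
theorem pd_corrugated_correction (i : Fin d) {a p q : (Fin d → ℝ) → ℝ}
    (hf : DifferentiableAt ℝ f x) (ha : DifferentiableAt ℝ a x) (hp : DifferentiableAt ℝ p x)
    (hq : DifferentiableAt ℝ q x) {lam : ℝ} (hlam : lam ≠ 0) (η : Fin d → ℝ) (e : ℝ) :
    pd i (fun y => f y - (1 / lam) * a y * (2 * Real.sin (lam * ∑ i, y i * η i)) * p y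
        - (1 / lam ^ 2) * a y * (-(1/2) * Real.cos (2 * (lam * ∑ i, y i * η i))) * q y
        + (1 / lam) * a y ^ 2 * (-(1/2) * Real.sin (2 * (lam * ∑ i, y i * η i))) * e) x
      = pd i f x
        - ((1 / lam) * pd i a x * (2 * Real.sin (lam * ∑ i, x i * η i))
            + a x * (2 * Real.cos (lam * ∑ i, x i * η i)) * η i) * p x
        - (1 / lam) * a x * (2 * Real.sin (lam * ∑ i, x i * η i)) * pd i p x
        - ((1 / lam ^ 2) * pd i a x * (-(1/2) * Real.cos (2 * (lam * ∑ i, x i * η i)))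
            + (1 / lam) * a x * Real.sin (2 * (lam * ∑ i, x i * η i)) * η i) * q x
        - (1 / lam ^ 2) * a x * (-(1/2) * Real.cos (2 * (lam * ∑ i, x i * η i))) * pd i q x
        - ((1 / lam) * a x * pd i a x * Real.sin (2 * (lam * ∑ i, x i * η i))
            + a x ^ 2 * Real.cos (2 * (lam * ∑ i, x i * η i)) * η i) * e := by
  simp only [← mul_assoc (2 : ℝ) lam, pow_two (a _)]
  simp (discharger := fun_prop) only [pd_add, pd_sub, pd_mul, pd_const, pd_sin_phase,
    pd_cos_phase]
  field_simp
  ring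

end PartialDerivatives

/-- Expansion of `⟨p + s • E, q + t • E⟩` for a unit vector `E`. -/
theorem sum_add_mul_mul_add_mul {ι : Type*} [Fintype ι] {E : ι → ℝ} (hE : ∑ l, E l ^ 2 = 1)
    (p q : ι → ℝ) (s t : ℝ) :
    ∑ l, (p l + s * E l) * (q l + t * E l)
      = ∑ l, p l * q l + t * ∑ l, p l * E l + s * ∑ l, q l * E l + s * t := by
  have h (l : ι) : (p l + s * E l) * (q l + t * E l)
      = p l * q l + t * (p l * E l) + s * (q l * E l) + s * t * E l ^ 2 := by ring
  simp only [h, Finset.sum_add_distrib, ← Finset.mul_sum, hE, mul_one]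

/-- Lemma 2.1: the basic "step" construction by Kuiper's corrugations, with
`Γ(t) = 2 sin t`, `Γ̄(t) = −½cos(2t)`, `Γ̄̄(t) = −½sin(2t)` and `t_η = ⟨x,η⟩`. -/
theorem step_corrugation
    {d k : ℕ} (ω : Set (Fin d → ℝ)) (hω : IsOpen ω)
    (v : (Fin d → ℝ) → Fin k → ℝ) (w : (Fin d → ℝ) → Fin d → ℝ)
    (hv : ContDiffOn ℝ 2 v ω) (hw : ContDiffOn ℝ 1 w ω)
    (η : Fin d → ℝ) (E : Fin k → ℝ)
    (hη : ∑ i, η i ^ 2 = 1) (hE : ∑ l, E l ^ 2 = 1)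
    (lam : ℝ) (hlam : 0 < lam)
    (a : (Fin d → ℝ) → ℝ) (ha : ContDiffOn ℝ 2 a ω)
    (vt : (Fin d → ℝ) → Fin k → ℝ) (wt : (Fin d → ℝ) → Fin d → ℝ)
    (hvt : vt = fun x l => v x l
      + (1 / lam) * a x * (2 * Real.sin (lam * ∑ i, x i * η i)) * E l)
    (hwt : wt = fun x j => w x j
      - (1 / lam) * a x * (2 * Real.sin (lam * ∑ i, x i * η i))
          * pd j (fun y => ∑ l, v y l * E l) x
      - (1 / lam ^ 2) * a x * (-(1/2) * Real.cos (2 * (lam * ∑ i, x i * η i)))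
          * pd j a x
      + (1 / lam) * a x ^ 2 * (-(1/2) * Real.sin (2 * (lam * ∑ i, x i * η i)))
          * η j) :
    (∀ x ∈ ω, ∀ i j : Fin d,
      ((1/2) * gradTgrad vt x i j + symGrad wt x i j)
        - ((1/2) * gradTgrad v x i j + symGrad w x i j)
        - a x ^ 2 * η i * η j
      = -(1 / lam) * a x * (2 * Real.sin (lam * ∑ i', x i' * η i'))
            * pd i (fun y => pd j (fun z => ∑ l, v z l * E l) y) x
        + (1 / lam ^ 2) * ((1/2) * (2 * Real.sin (lam * ∑ i', x i' * η i')) ^ 2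
              - (-(1/2) * Real.cos (2 * (lam * ∑ i', x i' * η i'))))
            * pd i a x * pd j a x
        - (1 / lam ^ 2) * a x * (-(1/2) * Real.cos (2 * (lam * ∑ i', x i' * η i')))
            * pd i (fun y => pd j a y) x)
    ∧ (∀ t : ℝ,
        (1/2) * (2 * Real.sin t) ^ 2 - (-(1/2) * Real.cos (2 * t))
          = 1 - (1/2) * Real.cos (2 * t)) := by
  have hl : lam ≠ 0 := hlam.ne'
  refine ⟨fun x hx i j => ?_, fun t => ?_⟩
  · have hx' : ω ∈ nhds x := hω.mem_nhds hx
    have ha2 : ContDiffAt ℝ 2 a x := ha.contDiffAt hx'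
    have hv2 (l : Fin k) : ContDiffAt ℝ 2 (fun y => v y l) x :=
      contDiffAt_pi.1 (hv.contDiffAt hx') l
    have hw1 (m : Fin d) : DifferentiableAt ℝ (fun y => w y m) x :=
      (contDiffAt_pi.1 (hw.contDiffAt hx') m).differentiableAt (by norm_num)
    have hV2 : ContDiffAt ℝ 2 (fun y => ∑ l, v y l * E l) x :=
      ContDiffAt.sum fun l _ => (hv2 l).mul contDiffAt_const
    have ha1 : DifferentiableAt ℝ a x := ha2.differentiableAt (by norm_num)
    have hv1 (l : Fin k) : DifferentiableAt ℝ (fun y => v y l) x :=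
      (hv2 l).differentiableAt (by norm_num)
    subst hvt hwt
    simp only [gradTgrad, symGrad]
    simp only [pd_corrugated_map _ (hv1 _) ha1 hl,
      pd_corrugated_correction _ (hw1 _) ha1 (hV2.differentiableAt_pd _)
        (ha2.differentiableAt_pd _) hl,
      sum_add_mul_mul_add_mul hE, hV2.pd_comm j i, ha2.pd_comm j i, pd_sum_mul_const _ hv1]
    rw [Real.sin_two_mul, Real.cos_two_mul']
    have hsc := Real.sin_sq_add_cos_sq (lam * ∑ i', x i' * η i')
    field_simp
    linear_combination (4 * lam ^ 2 * a x ^ 2 * η i * η j) * hsc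
  · rw [Real.cos_two_mul, Real.cos_sq']
    ring
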